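/- Let (X,Z) be an HMM with finite state space S, and fix f : S → ℝ. For the dual backward stochastic difference equation Y_t(x) = (A Y_{t+1})(x) + c(x)ᵀ(U_t + V_t(x)) - V_t(x)ᵀ e(Z_{t+1}) with terminal condition Y_T = f and given adapted control U, there exists a unique adapted solution pair (Y, V) (with Y_t, V_t measurable with respect to σ(Z_1,...,Z_t)), provided P(Z_1=z_1,...,Z_T=z_T) > 0 for all sequences (z_1,...,z_T) ∈ O^T. -/

import Mathlib

open Finset Matrix MeasureTheory

def stdBasis (m : ℕ) (i : Fin m) : Fin m → ℝ := fun j => if j = i then 1 else 0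

/-- The balanced encoding `e : {0,1,…,m} → ℝ^m`. -/
def balancedEncoding (m : ℕ) (z : Fin (m + 1)) : Fin m → ℝ :=
  if h : (z : ℕ) = 0 then -∑ i : Fin m, stdBasis m i
  else stdBasis m ⟨(z : ℕ) - 1, by omega⟩

section

variable (d m : ℕ) (A : Fin d → Fin d → ℝ) (Cmat : Fin d → Fin (m + 1) → ℝ)

/-- `c(x)_i = C(x,i) - C(x,0)`. -/
def cvec (x : Fin d) : Fin m → ℝ := fun i => Cmat x i.succ - Cmat x 0

/-- The σ-algebra generated by the observations `Z_1,…,Z_t`. -/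
def obsFiltration {Ω : Type*} (Z : ℕ → Ω → Fin (m + 1)) (T t : ℕ) :
    MeasurableSpace Ω :=
  ⨆ s : Fin T, ⨆ _ : (s : ℕ) < t, MeasurableSpace.comap (Z ((s : ℕ) + 1)) ⊤

/-- A pair `(Y,V)` is an adapted solution of the dual BSΔE with control `U`
and terminal condition `f`. -/
def IsBSDESol {Ω : Type*} [MeasurableSpace Ω] (P : Measure Ω) (T : ℕ)
    (f : Fin d → ℝ) (U : ℕ → Ω → Fin m → ℝ)
    (Z : ℕ → Ω → Fin (m + 1))
    (Y : ℕ → Fin d → Ω → ℝ) (V : ℕ → Fin d → Ω → Fin m → ℝ) : Prop :=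
  (∀ t ≤ T, ∀ x, Measurable[obsFiltration m Z T t] (Y t x)) ∧
  (∀ t < T, ∀ x, Measurable[obsFiltration m Z T t] (V t x)) ∧
  (∀ x, Y T x = fun _ => f x) ∧
  (∀ t < T, ∀ x, ∀ᵐ ω ∂P,
    Y t x ω = (∑ y, A x y * Y (t + 1) y ω) +
      cvec d m Cmat x ⬝ᵥ (U t ω + V t x ω) -
      V t x ω ⬝ᵥ balancedEncoding m (Z (t + 1) ω))

end

/-- Two sample points have the same first `t` observations, within the horizon `T`. -/
def SameObs {Ω : Type*} {m : ℕ} (Z : ℕ → Ω → Fin (m + 1)) (T t : ℕ) (ω ω' : Ω) : Prop :=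
  ∀ s : Fin T, (s : ℕ) < t → Z ((s : ℕ) + 1) ω = Z ((s : ℕ) + 1) ω'

lemma measurable_obsFiltration_iff {Ω β : Type*} [MeasurableSpace β] [MeasurableSingletonClass β]
    {m : ℕ} (Z : ℕ → Ω → Fin (m + 1)) (T t : ℕ) (g : Ω → β) :
    Measurable[obsFiltration m Z T t] g ↔ ∀ ω ω', SameObs Z T t ω ω' → g ω = g ω' := by
  let φ : Ω → Fin T → Fin (m + 1) := fun ω s => if (s : ℕ) < t then Z ((s : ℕ) + 1) ω else 0
  have hφ {ω ω'} : φ ω = φ ω' ↔ SameObs Z T t ω ω' := by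
    simp only [φ, funext_iff, SameObs]
    refine forall_congr' fun s => ?_
    by_cases hs : (s : ℕ) < t <;> simp [hs]
  constructor
  · intro hg ω ω' h
    have hle : obsFiltration m Z T t ≤ MeasurableSpace.comap φ inferInstance := by
      refine iSup_le fun s => iSup_le fun hs => ?_
      rintro _ ⟨B, -, rfl⟩
      exact ⟨{p | p s ∈ B}, (Set.toFinite _).measurableSet, by ext; simp [φ, hs]⟩
    obtain ⟨B, -, hB⟩ := hle _ (hg (measurableSet_singleton (g ω)))
    have h1 : ω ∈ φ ⁻¹' B := by rw [hB]; rfl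
    have h2 : ω' ∈ φ ⁻¹' B := by rwa [Set.mem_preimage, ← hφ.2 h]
    rw [hB] at h2
    exact Eq.symm h2
  · intro h
    have hφm : Measurable[obsFiltration m Z T t] φ := by
      refine @measurable_pi_lambda _ _ _ (obsFiltration m Z T t) _ φ fun s => ?_
      by_cases hs : (s : ℕ) < t
      · have hle : MeasurableSpace.comap (Z ((s : ℕ) + 1)) ⊤ ≤ obsFiltration m Z T t :=
          le_iSup₂_of_le s hs le_rfl
        simp only [φ, hs, if_true]
        exact fun B _ => hle _ ⟨B, trivial, rfl⟩
      · simp only [φ, hs, if_false]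
        exact @measurable_const _ _ _ (obsFiltration m Z T t) _
    rcases isEmpty_or_nonempty Ω with hΩ | ⟨⟨ω₀⟩⟩
    · intro B _
      rw [Set.eq_empty_of_isEmpty (g ⁻¹' B)]
      exact @MeasurableSet.empty _ (obsFiltration m Z T t)
    · have hfac : g.FactorsThrough φ := fun ω ω' e => h ω ω' (hφ.1 e)
      rw [← hfac.extend_comp fun _ => g ω₀]
      exact (measurable_of_finite _).comp hφm

lemma dotProduct_balancedEncoding_zero {m : ℕ} (v : Fin m → ℝ) :
    v ⬝ᵥ balancedEncoding m 0 = -∑ i, v i := by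
  simp [balancedEncoding, dotProduct, _root_.stdBasis, Finset.sum_apply]

lemma dotProduct_balancedEncoding_succ {m : ℕ} (v : Fin m → ℝ) (i : Fin m) :
    v ⬝ᵥ balancedEncoding m i.succ = v i := by
  simp [balancedEncoding, dotProduct, _root_.stdBasis]

/-- A function on `{0,…,m}` is uniquely a constant plus a part linear in the encoding. -/
lemma eq_add_dotProduct_balancedEncoding_iff {m : ℕ} (h : Fin (m + 1) → ℝ) (a : ℝ)
    (v : Fin m → ℝ) :
    (∀ z, h z = a + v ⬝ᵥ balancedEncoding m z) ↔
      a = (∑ z, h z) / (m + 1) ∧ ∀ i, v i = h i.succ - (∑ z, h z) / (m + 1) := by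
  have hm : (m + 1 : ℝ) ≠ 0 := by positivity
  simp only [Fin.forall_fin_succ, dotProduct_balancedEncoding_zero,
    dotProduct_balancedEncoding_succ]
  constructor
  · rintro ⟨h0, hs⟩
    have ha : a = (∑ z, h z) / (m + 1) := by
      rw [eq_div_iff hm, Fin.sum_univ_succ, h0]
      simp only [hs, Finset.sum_add_distrib]
      simp
      ring
    refine ⟨ha, fun i => ?_⟩
    rw [← ha, hs i]
    ring
  · rintro ⟨ha, hs⟩
    rw [← ha] at hs
    refine ⟨?_, fun i => by rw [hs]; ring⟩
    rw [eq_div_iff hm, Fin.sum_univ_succ] at ha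
    simp only [hs, Finset.sum_sub_distrib]
    simp
    linarith

lemma exists_sameObs_of_ae {Ω : Type*} [MeasurableSpace Ω] {P : Measure Ω} {m T : ℕ}
    {Z : ℕ → Ω → Fin (m + 1)}
    (hpos : ∀ zs : Fin T → Fin (m + 1), 0 < P {ω | ∀ t : Fin T, Z ((t : ℕ) + 1) ω = zs t})
    {p : Ω → Prop} (hp : ∀ᵐ ω ∂P, p ω) {t : ℕ} (ht : t < T) (ω : Ω) (z : Fin (m + 1)) :
    ∃ ω', p ω' ∧ SameObs Z T t ω ω' ∧ Z (t + 1) ω' = z := by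
  obtain ⟨ω', h, hω'⟩ := ((frequently_ae_mem_iff.2 (hpos (Function.update
    (fun s : Fin T => Z ((s : ℕ) + 1) ω) ⟨t, ht⟩ z)).ne').and_eventually hp).exists
  refine ⟨ω', hω', fun s hs => ?_, ?_⟩
  · have := h s
    rw [Function.update_of_ne (by rintro rfl; exact lt_irrefl _ hs)] at this
    exact this.symm
  · simpa using h ⟨t, ht⟩

section

variable {d m : ℕ} {A : Fin d → Fin d → ℝ} {Cmat : Fin d → Fin (m + 1) → ℝ}
  {Ω : Type*} [MeasurableSpace Ω] {P : Measure Ω} {T : ℕ} {Z : ℕ → Ω → Fin (m + 1)}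
  {f : Fin d → ℝ} {U : ℕ → Ω → Fin m → ℝ}

lemma exists_isBSDESol
    (hpos : ∀ zs : Fin T → Fin (m + 1), 0 < P {ω | ∀ t : Fin T, Z ((t : ℕ) + 1) ω = zs t})
    (hUad : ∀ t < T, Measurable[obsFiltration m Z T t] (U t)) :
    ∃ Y V, IsBSDESol d m A Cmat P T f U Z Y V := by
  have hsec (zs : Fin T → Fin (m + 1)) : ∃ ω, ∀ t : Fin T, Z ((t : ℕ) + 1) ω = zs t :=
    nonempty_of_measure_ne_zero (hpos zs).ne'
  choose p hp using hsec
  let r : ℕ → Ω → Fin (m + 1) → Ω := fun t ω z => p fun s =>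
    if (s : ℕ) < t then Z ((s : ℕ) + 1) ω else z
  have hr_congr {t ω ω'} (h : SameObs Z T t ω ω') (z) : r t ω z = r t ω' z := by
    refine congrArg p (funext fun s => ?_)
    split_ifs with hs
    exacts [h s hs, rfl]
  have hr_same (t ω) : SameObs Z T (t + 1) (r t ω (Z (t + 1) ω)) ω := by
    intro s hs
    rw [hp]
    split_ifs with hst
    · rfl
    · rw [show (s : ℕ) = t by omega]
  let H : ℕ → (Fin d → Ω → ℝ) → Fin d → Ω → Fin (m + 1) → ℝ := fun t y x ω z =>
    ∑ x', A x x' * y x' (r t ω z)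
  let M : ℕ → (Fin d → Ω → ℝ) → Fin d → Ω → ℝ := fun t y x ω => (∑ z, H t y x ω z) / (m + 1)
  let W : ℕ → (Fin d → Ω → ℝ) → Fin d → Ω → Fin m → ℝ := fun t y x ω i =>
    H t y x ω i.succ - M t y x ω
  let F : ℕ → Fin d → Ω → ℝ := fun k => k.rec (fun x _ => f x) fun k y x ω =>
    M (T - (k + 1)) y x ω + cvec d m Cmat x ⬝ᵥ (U (T - (k + 1)) ω + W (T - (k + 1)) y x ω)
  have hF {t} (ht : t < T) (x ω) : F (T - t) x ω = M t (F (T - (t + 1))) x ω +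
      cvec d m Cmat x ⬝ᵥ (U t ω + W t (F (T - (t + 1))) x ω) := by
    obtain ⟨k, rfl⟩ : ∃ k, T = t + (k + 1) := ⟨T - t - 1, by omega⟩
    rw [show t + (k + 1) - t = k + 1 by omega, show t + (k + 1) - (t + 1) = k by omega]
    change M (t + (k + 1) - (k + 1)) _ _ _ + _ ⬝ᵥ (U (t + (k + 1) - (k + 1)) ω +
      W (t + (k + 1) - (k + 1)) _ _ _) = _
    rw [Nat.add_sub_cancel]
  have hH {t y x ω ω'} (h : SameObs Z T t ω ω') : H t y x ω = H t y x ω' := by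
    funext z
    simp only [H, hr_congr h]
  have hM {t y x ω ω'} (h : SameObs Z T t ω ω') : M t y x ω = M t y x ω' := by
    simp only [M, hH h]
  have hW {t y x ω ω'} (h : SameObs Z T t ω ω') : W t y x ω = W t y x ω' := by
    funext i
    simp only [W, hH h, hM h]
  have hFobs {t} (ht : t ≤ T) (x ω ω') (h : SameObs Z T t ω ω') :
      F (T - t) x ω = F (T - t) x ω' := by
    rcases ht.lt_or_eq with ht | rfl
    · rw [hF ht, hF ht, hM h, hW h, (measurable_obsFiltration_iff Z T t _).1 (hUad t ht) ω ω' h]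
    · simp [F]
  refine ⟨fun t => F (T - t), fun t => W t (F (T - (t + 1))), fun t ht x => ?_, fun t ht x => ?_,
    fun x => by simp [F], fun t ht x => .of_forall fun ω => ?_⟩
  · exact (measurable_obsFiltration_iff Z T t _).2 (hFobs ht x)
  · exact (measurable_obsFiltration_iff Z T t _).2 fun ω ω' h => hW h
  · have key := (eq_add_dotProduct_balancedEncoding_iff (H t (F (T - (t + 1))) x ω)
      (M t (F (T - (t + 1))) x ω) (W t (F (T - (t + 1))) x ω)).2 ⟨rfl, fun _ => rfl⟩
      (Z (t + 1) ω)
    have hsum : H t (F (T - (t + 1))) x ω (Z (t + 1) ω) =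
        ∑ y, A x y * F (T - (t + 1)) y ω :=
      Finset.sum_congr rfl fun y _ => by rw [hFobs ht y _ _ (hr_same t ω)]
    change F (T - t) x ω = _
    rw [hF ht, ← hsum, key]
    ring

lemma IsBSDESol.eq_of_succ_eq
    (hpos : ∀ zs : Fin T → Fin (m + 1), 0 < P {ω | ∀ t : Fin T, Z ((t : ℕ) + 1) ω = zs t})
    (hUad : ∀ t < T, Measurable[obsFiltration m Z T t] (U t))
    {Y V Y' V'} (h : IsBSDESol d m A Cmat P T f U Z Y V)
    (h' : IsBSDESol d m A Cmat P T f U Z Y' V') {t : ℕ} (ht : t < T)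
    (hnext : Y (t + 1) = Y' (t + 1)) (x : Fin d) : Y t x = Y' t x ∧ V t x = V' t x := by
  suffices H : ∀ ω, Y t x ω = Y' t x ω ∧ V t x ω = V' t x ω from
    ⟨funext fun ω => (H ω).1, funext fun ω => (H ω).2⟩
  intro ω
  obtain ⟨hY, hV, -, heq⟩ := h
  obtain ⟨hY', hV', -, heq'⟩ := h'
  choose q hq hsame hz using
    exists_sameObs_of_ae hpos ((heq t ht x).and (heq' t ht x)) ht ω
  have d1 := eq_add_dotProduct_balancedEncoding_iff (fun z => ∑ y, A x y * Y (t + 1) y (q z))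
    (Y t x ω - cvec d m Cmat x ⬝ᵥ (U t ω + V t x ω)) (V t x ω)
  have d2 := eq_add_dotProduct_balancedEncoding_iff (fun z => ∑ y, A x y * Y (t + 1) y (q z))
    (Y' t x ω - cvec d m Cmat x ⬝ᵥ (U t ω + V' t x ω)) (V' t x ω)
  have hU z := (measurable_obsFiltration_iff Z T t _).1 (hUad t ht) _ _ (hsame z)
  obtain ⟨a1, b1⟩ := d1.1 fun z => by
    have e := (hq z).1
    rw [hz, ← hU, ← (measurable_obsFiltration_iff Z T t _).1 (hY t ht.le x) _ _ (hsame z),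
      ← (measurable_obsFiltration_iff Z T t _).1 (hV t ht x) _ _ (hsame z)] at e
    linarith
  obtain ⟨a2, b2⟩ := d2.1 fun z => by
    have e := (hq z).2
    rw [hz, ← hU, ← (measurable_obsFiltration_iff Z T t _).1 (hY' t ht.le x) _ _ (hsame z),
      ← (measurable_obsFiltration_iff Z T t _).1 (hV' t ht x) _ _ (hsame z), ← hnext] at e
    linarith
  have hVV : V t x ω = V' t x ω := funext fun i => (b1 i).trans (b2 i).symm
  rw [hVV] at a1
  exact ⟨by linarith, hVV⟩

lemma IsBSDESol.eq
    (hpos : ∀ zs : Fin T → Fin (m + 1), 0 < P {ω | ∀ t : Fin T, Z ((t : ℕ) + 1) ω = zs t})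
    (hUad : ∀ t < T, Measurable[obsFiltration m Z T t] (U t))
    {Y V Y' V'} (h : IsBSDESol d m A Cmat P T f U Z Y V)
    (h' : IsBSDESol d m A Cmat P T f U Z Y' V') {t : ℕ} (ht : t ≤ T) : Y t = Y' t := by
  induction ht using Nat.decreasingInduction with
  | self => exact funext fun x => (h.2.2.1 x).trans (h'.2.2.1 x).symm
  | of_succ t ht ih => exact funext fun x => (h.eq_of_succ_eq hpos hUad h' ht ih x).1

end

section

variable (d m : ℕ) (A : Fin d → Fin d → ℝ) (Cmat : Fin d → Fin (m + 1) → ℝ)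

/-- existence and uniqueness of the adapted solution of the dual
BSΔE, under the positivity condition on the law of the observation path. -/
theorem bsde_existence_uniqueness {Ω : Type*} [MeasurableSpace Ω]
    (P : Measure Ω) [IsProbabilityMeasure P] (T : ℕ)
    (hA : ∀ x, (∀ y, 0 ≤ A x y) ∧ ∑ y, A x y = 1)
    (hC : ∀ x, (∀ z, 0 ≤ Cmat x z) ∧ ∑ z, Cmat x z = 1)
    (Z : ℕ → Ω → Fin (m + 1)) (hZm : ∀ t, Measurable (Z t))
    (hpos : ∀ zs : Fin T → Fin (m + 1),
      0 < P {ω | ∀ t : Fin T, Z ((t : ℕ) + 1) ω = zs t})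
    (f : Fin d → ℝ) (U : ℕ → Ω → Fin m → ℝ)
    (hUad : ∀ t < T, Measurable[obsFiltration m Z T t] (U t)) :
    (∃ Y V, IsBSDESol d m A Cmat P T f U Z Y V) ∧
    (∀ Y V Y' V', IsBSDESol d m A Cmat P T f U Z Y V →
      IsBSDESol d m A Cmat P T f U Z Y' V' →
      (∀ t ≤ T, ∀ x, Y t x =ᵐ[P] Y' t x) ∧
      (∀ t < T, ∀ x, V t x =ᵐ[P] V' t x)) := by
  refine ⟨exists_isBSDESol hpos hUad, fun Y V Y' V' h h' => ⟨fun t ht x => ?_, fun t ht x => ?_⟩⟩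
  · rw [h.eq hpos hUad h' ht]
  · rw [(h.eq_of_succ_eq hpos hUad h' ht (h.eq hpos hUad h' ht) x).2]

end
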